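/- arXiv:1510.04727 — 2 statements merged into one kernel-verified Lean document; each statement's English description precedes it below -/
import Mathlib

section
/- Let B be an n×n complex Hermitian positive semi-definite matrix with unit diagonal, L its strictly lower triangular part, b ∈ Ran(B), and ω ∈ (0,2). Then the SOR iterates y^{(k+1)} = y^{(k)} + ω(I + ωL)^{-1}(b − By^{(k)}) converge as k → ∞; the limit is u^{(0)} + v̄ and solves By = b, where y^{(0)} = u^{(0)} + v^{(0)} is the decomposition of the starting vector relative to the direct sum ℂⁿ = Ker(B) ⊕ (I + ωL)^{-1}Ran(B), and v̄ is the unique solution of By = b lying in (I + ωL)^{-1}Ran(B). -/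
open Matrix
open scoped ComplexOrder

/-- Spectral (operator ℓ²→ℓ²) norm of a complex square matrix. -/
noncomputable def specNorm {n : ℕ} (M : Matrix (Fin n) (Fin n) ℂ) : ℝ :=
  ‖Matrix.toEuclideanCLM (𝕜 := ℂ) (n := Fin n) M‖

/-- Strictly lower triangular part of a matrix. -/
def lowerTri {n : ℕ} (M : Matrix (Fin n) (Fin n) ℂ) : Matrix (Fin n) (Fin n) ℂ :=
  Matrix.of fun i j => if j < i then M i j else 0

/-- Squared energy seminorm |y|_B² = ⟨By, y⟩. -/
noncomputable def energySq {n : ℕ} (B : Matrix (Fin n) (Fin n) ℂ) (y : Fin n → ℂ) : ℝ :=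
  (star y ⬝ᵥ (B *ᵥ y)).re

/-- Euclidean norm of a vector in ℂⁿ. -/
noncomputable def euclNorm {n : ℕ} (v : Fin n → ℂ) : ℝ :=
  ‖(WithLp.equiv 2 (Fin n → ℂ)).symm v‖

/-- The matrix `I + ωL` is invertible, being unit lower triangular. -/
theorem isUnit_det_one_add_smul_lowerTri {n : ℕ} (B : Matrix (Fin n) (Fin n) ℂ) (c : ℂ) :
    IsUnit (1 + c • lowerTri B).det := by
  rw [Matrix.det_of_isLowerTriangular]
  · simp [lowerTri]
  · intro i j hij
    have hij' : i < j := hij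
    simp [lowerTri, hij'.ne, hij'.not_gt]

theorem add_conjTranspose_one_add_smul_lowerTri {n : ℕ} {B : Matrix (Fin n) (Fin n) ℂ}
    (hB : B.IsHermitian) (hdiag : ∀ i, B i i = 1) (ω : ℝ) :
    (1 + (ω : ℂ) • lowerTri B) + (1 + (ω : ℂ) • lowerTri B)ᴴ =
      (2 - ω : ℂ) • (1 : Matrix (Fin n) (Fin n) ℂ) + (ω : ℂ) • B := by
  ext i j
  have hij : star (B j i) = B i j := hB.apply i j
  rcases lt_trichotomy i j with h | rfl | h
  · simp_all [lowerTri, h.ne, h.not_gt]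
  · simp [lowerTri, hdiag]
    ring
  · simp_all [lowerTri, h.ne', h.not_gt]

theorem dotProduct_one_add_smul_lowerTri_add {n : ℕ} {B : Matrix (Fin n) (Fin n) ℂ}
    (hB : B.IsHermitian) (hdiag : ∀ i, B i i = 1) (ω : ℝ) (w : Fin n → ℂ) :
    star w ⬝ᵥ ((1 + (ω : ℂ) • lowerTri B) *ᵥ w) + star ((1 + (ω : ℂ) • lowerTri B) *ᵥ w) ⬝ᵥ w =
      (2 - ω : ℂ) * (star w ⬝ᵥ w) + ω * (star w ⬝ᵥ (B *ᵥ w)) := by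
  rw [Matrix.star_mulVec, ← Matrix.dotProduct_mulVec, ← dotProduct_add, ← Matrix.add_mulVec,
    add_conjTranspose_one_add_smul_lowerTri hB hdiag]
  simp [Matrix.add_mulVec, Matrix.smul_mulVec, dotProduct_add]

/-- The energy lost in one SOR step with search direction `w`. -/
theorem energySq_sub_smul {n : ℕ} {B : Matrix (Fin n) (Fin n) ℂ}
    (hB : B.IsHermitian) (hdiag : ∀ i, B i i = 1) (ω : ℝ) {e w : Fin n → ℂ}
    (hw : (1 + (ω : ℂ) • lowerTri B) *ᵥ w = B *ᵥ e) :
    energySq B (e - (ω : ℂ) • w) = energySq B e - ω * (2 - ω) * (star w ⬝ᵥ w).re := by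
  have h := dotProduct_one_add_smul_lowerTri_add hB hdiag ω w
  rw [hw, Matrix.star_mulVec, ← Matrix.dotProduct_mulVec, hB.eq] at h
  have key : star (e - (ω : ℂ) • w) ⬝ᵥ (B *ᵥ (e - (ω : ℂ) • w)) =
      star e ⬝ᵥ (B *ᵥ e) - ((ω * (2 - ω) : ℝ) : ℂ) * (star w ⬝ᵥ w) := by
    simp only [star_sub, star_smul, Matrix.mulVec_sub, Matrix.mulVec_smul, sub_dotProduct,
      dotProduct_sub, smul_dotProduct, dotProduct_smul, smul_eq_mul, Complex.star_def,
      Complex.conj_ofReal]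
    push_cast
    linear_combination (-ω : ℂ) * h
  simp only [energySq, key, Complex.sub_re, Complex.re_ofReal_mul]

theorem eq_zero_of_one_add_smul_lowerTri_mulVec_eq {n : ℕ} {B : Matrix (Fin n) (Fin n) ℂ}
    (hB : B.IsHermitian) (hdiag : ∀ i, B i i = 1) {ω : ℝ} (hω2 : ω < 2) {e z : Fin n → ℂ}
    (hz : (1 + (ω : ℂ) • lowerTri B) *ᵥ e = B *ᵥ z) (he : B *ᵥ e = 0) : e = 0 := by
  have h := dotProduct_one_add_smul_lowerTri_add hB hdiag ω e
  have he' : star e ᵥ* B = 0 := by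
    have := Matrix.star_mulVec B e
    rw [he, hB.eq] at this
    simpa using this.symm
  rw [hz, Matrix.star_mulVec, hB.eq, Matrix.dotProduct_mulVec, he', ← Matrix.dotProduct_mulVec,
    he] at h
  have hω : (2 - ω : ℂ) ≠ 0 := by
    exact_mod_cast (sub_pos.2 hω2).ne'
  rw [← dotProduct_star_self_eq_zero, dotProduct_comm]
  simpa [hω] using h.symm

theorem tendsto_zero_of_tendsto_dotProduct_star_self {n : ℕ} {w : ℕ → Fin n → ℂ}
    (h : Filter.Tendsto (fun k => (star (w k) ⬝ᵥ w k).re) Filter.atTop (nhds 0)) :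
    Filter.Tendsto w Filter.atTop (nhds 0) := by
  have hnorm (v : Fin n → ℂ) : (star v ⬝ᵥ v).re = ∑ i, ‖v i‖ ^ 2 := by
    simp [dotProduct, ← Complex.normSq_eq_norm_sq, Complex.normSq_apply]
  simp only [hnorm] at h
  refine tendsto_pi_nhds.2 fun i => tendsto_zero_iff_norm_tendsto_zero.2 ?_
  have hsq : Filter.Tendsto (fun k => ‖w k i‖ ^ 2) Filter.atTop (nhds 0) :=
    squeeze_zero (fun k => by positivity) (fun k => Finset.single_le_sum
      (f := fun i => ‖w k i‖ ^ 2) (fun j _ => by positivity) (Finset.mem_univ i)) h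
  simpa using hsq.sqrt

/-- The homogeneous SOR iteration started in `(I + ωL)⁻¹ Ran(B)` tends to zero. -/
theorem sor_error_tendsto_zero {n : ℕ} {B : Matrix (Fin n) (Fin n) ℂ}
    (hB : B.PosSemidef) (hdiag : ∀ i, B i i = 1) {ω : ℝ} (hω0 : 0 < ω) (hω2 : ω < 2)
    {e : ℕ → Fin n → ℂ}
    (he : ∀ k, e (k + 1) = e k - (ω : ℂ) • ((1 + (ω : ℂ) • lowerTri B)⁻¹ *ᵥ (B *ᵥ e k)))
    (he0 : e 0 ∈ (LinearMap.range B.mulVecLin).map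
      ((1 + (ω : ℂ) • lowerTri B)⁻¹).mulVecLin) :
    Filter.Tendsto e Filter.atTop (nhds 0) := by
  have hM := isUnit_det_one_add_smul_lowerTri B (ω : ℂ)
  set M := 1 + (ω : ℂ) • lowerTri B
  set W := (LinearMap.range B.mulVecLin).map (M⁻¹).mulVecLin
  have hMw (v : Fin n → ℂ) : M *ᵥ (M⁻¹ *ᵥ v) = v := by
    rw [Matrix.mulVec_mulVec, Matrix.mul_nonsing_inv _ hM, Matrix.one_mulVec]
  have heW (k : ℕ) : e k ∈ W := by
    induction k with
    | zero => exact he0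
    | succ k ih =>
      rw [he]
      exact W.sub_mem ih (W.smul_mem _ ⟨B *ᵥ e k, ⟨e k, rfl⟩, rfl⟩)
  set w : ℕ → Fin n → ℂ := fun k => M⁻¹ *ᵥ (B *ᵥ e k)
  have hstep (k : ℕ) : energySq B (e (k + 1)) =
      energySq B (e k) - ω * (2 - ω) * (star (w k) ⬝ᵥ w k).re := by
    rw [he]
    exact energySq_sub_smul hB.isHermitian hdiag ω (hMw _)
  have hc : 0 < ω * (2 - ω) := mul_pos hω0 (sub_pos.2 hω2)
  have hanti : Antitone fun k => energySq B (e k) := by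
    refine antitone_nat_of_succ_le fun k => ?_
    rw [hstep]
    have : 0 ≤ (star (w k) ⬝ᵥ w k).re :=
      (Complex.nonneg_iff.1 (dotProduct_star_self_nonneg (w k))).1
    exact sub_le_self _ (mul_nonneg hc.le this)
  have hbdd : BddBelow (Set.range fun k => energySq B (e k)) := by
    refine ⟨0, ?_⟩
    rintro _ ⟨k, rfl⟩
    exact hB.re_dotProduct_nonneg (e k)
  have hlim := tendsto_atTop_ciInf hanti hbdd
  have hw0 : Filter.Tendsto w Filter.atTop (nhds 0) := by
    apply tendsto_zero_of_tendsto_dotProduct_star_self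
    have h := (hlim.sub (hlim.comp (Filter.tendsto_add_atTop_nat 1))).div_const (ω * (2 - ω))
    simp only [sub_self, zero_div] at h
    refine h.congr fun k => ?_
    simp only [Function.comp_apply, hstep]
    rw [sub_sub_cancel, mul_div_cancel_left₀ _ hc.ne']
  have hBe : Filter.Tendsto (fun k => B *ᵥ e k) Filter.atTop (nhds 0) := by
    have h := (M.mulVecLin.continuous_of_finiteDimensional.tendsto 0).comp hw0
    rw [map_zero] at h
    exact h.congr fun k => hMw _
  have hker : LinearMap.ker (B.mulVecLin.domRestrict W) = ⊥ := by
    refine LinearMap.ker_eq_bot'.2 ?_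
    rintro ⟨_, _, ⟨z, rfl⟩, rfl⟩ h
    exact Subtype.ext (eq_zero_of_one_add_smul_lowerTri_mulVec_eq hB.isHermitian hdiag hω2
      (hMw _) h)
  obtain ⟨g, hg⟩ := LinearMap.exists_leftInverse_of_injective _ hker
  have hgt := ((W.subtype ∘ₗ g).continuous_of_finiteDimensional.tendsto 0).comp hBe
  rw [map_zero] at hgt
  refine hgt.congr fun k => ?_
  exact congrArg Subtype.val (LinearMap.congr_fun hg ⟨e k, heW k⟩)

/-- Convergence of the SOR iterates: y^{(k)} → u⁰ + v̄, a solution of By = b. -/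
theorem sor_iterates_converge {n : ℕ} (B : Matrix (Fin n) (Fin n) ℂ)
    (hB : B.PosSemidef) (hdiag : ∀ i, B i i = 1)
    (ω : ℝ) (hω0 : 0 < ω) (hω2 : ω < 2)
    (b : Fin n → ℂ) (hb : ∃ z, B *ᵥ z = b)
    (y : ℕ → Fin n → ℂ)
    (hy : ∀ k, y (k+1) = y k + (ω : ℂ) • ((1 + (ω : ℂ) • lowerTri B)⁻¹ *ᵥ (b - B *ᵥ y k)))
    (u0 v0 : Fin n → ℂ)
    (hu0 : u0 ∈ LinearMap.ker B.mulVecLin)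
    (hv0 : v0 ∈ (LinearMap.range B.mulVecLin).map
        ((1 + (ω : ℂ) • lowerTri B)⁻¹).mulVecLin)
    (hy0 : y 0 = u0 + v0)
    (vbar : Fin n → ℂ)
    (hvbar : vbar ∈ (LinearMap.range B.mulVecLin).map
        ((1 + (ω : ℂ) • lowerTri B)⁻¹).mulVecLin)
    (hvbar_sol : B *ᵥ vbar = b) :
    Filter.Tendsto y Filter.atTop (nhds (u0 + vbar)) ∧ B *ᵥ (u0 + vbar) = b := by
  have hu : B *ᵥ u0 = 0 := hu0
  have hsol : B *ᵥ (u0 + vbar) = b := by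
    rw [Matrix.mulVec_add, hu, hvbar_sol, zero_add]
  refine ⟨?_, hsol⟩
  have he : Filter.Tendsto (fun k => y k - (u0 + vbar)) Filter.atTop (nhds 0) := by
    refine sor_error_tendsto_zero hB hdiag hω0 hω2 (fun k => ?_) ?_
    · rw [hy, Matrix.mulVec_sub B, hsol, ← neg_sub b, Matrix.mulVec_neg, smul_neg]
      abel
    · rw [hy0, add_sub_add_left_eq_sub]
      exact Submodule.sub_mem _ hv0 hvbar
  exact tendsto_sub_nhds_zero_iff.1 he
end

section
/- Let B be an n×n complex Hermitian positive semi-definite matrix with unit diagonal, λ₁ its largest eigenvalue, λ_r its smallest nonzero eigenvalue, κ̄ = λ₁/λ_r, b ∈ Ran(B), ȳ a solution of Bȳ = b, and ω ∈ (0,2). Consider the single-step randomized SOR iteration: given the current vector y and an index i ∈ {1,…,n} chosen uniformly at random, replace y by y + ω(b_i − (By)_i)e_i, where e_i is the i-th standard basis vector; one iteration step consists of n such single steps with independent uniform indices. Then for all k ≥ 1, the expectation over the kn independent uniform indices satisfies E(|ȳ − y^{(k)}|_B²) ≤ (1 − (2−ω)ω λ₁/(n κ̄))^{kn} · |ȳ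 − y^{(0)}|_B². -/
open Matrix
open scoped ComplexOrder

/-- A relaxed coordinate step along `i` decreases the energy by `(2 - ω) ω |(B e)ᵢ|²`. -/
theorem energySq_sub_smul_single {n : ℕ} {B : Matrix (Fin n) (Fin n) ℂ} (hB : B.IsHermitian)
    (e : Fin n → ℂ) (ω : ℝ) (i : Fin n) (hi : B i i = 1) :
    energySq B (e - ((ω : ℂ) * (B *ᵥ e) i) • (Pi.single i (1 : ℂ) : Fin n → ℂ)) =
      energySq B e - (2 - ω) * ω * Complex.normSq ((B *ᵥ e) i) := by
  have h1 : star e ⬝ᵥ (B *ᵥ (Pi.single i (1 : ℂ) : Fin n → ℂ)) = star ((B *ᵥ e) i) := by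
    rw [dotProduct_mulVec, dotProduct_single_one, ← hB.eq, ← star_mulVec, hB.eq, Pi.star_apply]
  have h2 : star (Pi.single i (1 : ℂ) : Fin n → ℂ) = Pi.single i 1 := by
    rw [Pi.star_single, star_one]
  have h3 : (B *ᵥ (Pi.single i (1 : ℂ) : Fin n → ℂ)) i = 1 := by
    rw [mulVec_single_one, col_apply, hi]
  unfold energySq
  rw [mulVec_sub, mulVec_smul, star_sub, star_smul, sub_dotProduct, dotProduct_sub,
    dotProduct_sub, smul_dotProduct, smul_dotProduct, dotProduct_smul, dotProduct_smul, h1, h2,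
    single_one_dotProduct, single_one_dotProduct, h3]
  simp [Complex.normSq_apply]
  ring

/-- If every nonzero eigenvalue is at least `c`, then `c ⟨B e, e⟩ ≤ ‖B e‖²`. -/
theorem mul_energySq_le_sum_normSq {n : ℕ} {B : Matrix (Fin n) (Fin n) ℂ} (hB : B.PosSemidef)
    {c : ℝ} (hc : ∀ i, hB.1.eigenvalues i ≠ 0 → c ≤ hB.1.eigenvalues i) (e : Fin n → ℂ) :
    c * energySq B e ≤ ∑ i, Complex.normSq ((B *ᵥ e) i) := by
  have hpsd : (B * B - (c : ℂ) • B).PosSemidef := by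
    have hD : (diagonal fun i =>
        ((hB.1.eigenvalues i * (hB.1.eigenvalues i - c) : ℝ) : ℂ)).PosSemidef := by
      refine PosSemidef.diagonal fun i => ?_
      rw [Pi.zero_apply, Complex.zero_le_real]
      by_cases h : hB.1.eigenvalues i = 0
      · simp [h]
      · exact mul_nonneg (hB.eigenvalues_nonneg i) (sub_nonneg.2 (hc i h))
    have hU := hD.mul_mul_conjTranspose_same (hB.1.eigenvectorUnitary : Matrix (Fin n) (Fin n) ℂ)
    convert hU using 1
    have hdiag : (diagonal fun i =>
        ((hB.1.eigenvalues i * (hB.1.eigenvalues i - c) : ℝ) : ℂ)) =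
        diagonal (RCLike.ofReal ∘ hB.1.eigenvalues) * diagonal (RCLike.ofReal ∘ hB.1.eigenvalues)
          - (c : ℂ) • diagonal (RCLike.ofReal ∘ hB.1.eigenvalues) := by
      rw [diagonal_mul_diagonal, ← diagonal_smul, diagonal_sub]
      congr 1
      ext i
      simp
      ring
    have hspec := hB.1.spectral_theorem
    rw [hdiag, ← star_eq_conjTranspose,
      ← Unitary.conjStarAlgAut_apply (S := ℂ), map_sub, map_mul, map_smul, ← hspec]
  have h := (Complex.le_def.1 (hpsd.dotProduct_mulVec_nonneg e)).1
  have hsq : star e ⬝ᵥ ((B * B) *ᵥ e) = ((∑ i, Complex.normSq ((B *ᵥ e) i) : ℝ) : ℂ) := by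
    rw [← mulVec_mulVec, dotProduct_mulVec]
    conv_lhs => enter [1]; rw [← hB.1.eq, ← star_mulVec]
    simp [dotProduct, Complex.normSq_eq_conj_mul_self]
  rw [sub_mulVec, dotProduct_sub, hsq, smul_mulVec, dotProduct_smul] at h
  simpa [energySq] using h

/-- An eigenvalue of a positive semidefinite matrix with unit diagonal is at most `n`. -/
theorem eigenvalues_le_card_of_unit_diag {n : ℕ} {B : Matrix (Fin n) (Fin n) ℂ}
    (hB : B.PosSemidef) (hdiag : ∀ i, B i i = 1) (i : Fin n) : hB.1.eigenvalues i ≤ n := by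
  have h : ((∑ j, hB.1.eigenvalues j : ℝ) : ℂ) = ((n : ℝ) : ℂ) := by
    have := hB.1.trace_eq_sum_eigenvalues
    simp [trace, hdiag] at this
    simp [← this]
  rw [← Complex.ofReal_injective h]
  exact Finset.single_le_sum (fun j _ => hB.eigenvalues_nonneg j) (Finset.mem_univ i)

/-- Strohmer–Vershynin type bound for the single-step randomized SOR iteration:
one iteration step consists of n single coordinate projection steps with
independently and uniformly chosen indices, and the expectation is the average
over all n^{kn} index sequences. -/
theorem single_step_randomized_sor_bound {n : ℕ} (B : Matrix (Fin n) (Fin n) ℂ)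
    (hB : B.PosSemidef) (hdiag : ∀ i, B i i = 1)
    (lam1 lamr : ℝ)
    (hlam1 : IsGreatest {μ : ℝ | ∃ i, hB.1.eigenvalues i = μ} lam1)
    (hlamr : IsLeast {μ : ℝ | (∃ i, hB.1.eigenvalues i = μ) ∧ μ ≠ 0} lamr)
    (b : Fin n → ℂ) (hb : ∃ z, B *ᵥ z = b)
    (ybar : Fin n → ℂ) (hybar : B *ᵥ ybar = b)
    (ω : ℝ) (hω0 : 0 < ω) (hω2 : ω < 2)
    (y0 : Fin n → ℂ)
    (y : ∀ m : ℕ, (Fin m → Fin n) → (Fin n → ℂ))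
    (hy0 : ∀ is, y 0 is = y0)
    (hrec : ∀ (m : ℕ) (is : Fin (m+1) → Fin n),
      y (m+1) is = y m (is ∘ Fin.castSucc) +
        ((ω : ℂ) * ((b - B *ᵥ y m (is ∘ Fin.castSucc)) (is (Fin.last m)))) •
          (Pi.single (is (Fin.last m)) (1 : ℂ) : Fin n → ℂ))
    (k : ℕ) (hk : 1 ≤ k) :
    ((n : ℝ)^(k*n))⁻¹ *
        ∑ is : Fin (k*n) → Fin n, energySq B (ybar - y (k*n) is)
      ≤ (1 - (2-ω)*ω*lam1 / ((n : ℝ) * (lam1/lamr)))^(k*n) * energySq B (ybar - y0) := by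
  obtain ⟨⟨⟨i₀, hi₀⟩, hne⟩, hmin⟩ := hlamr
  have hn : (0 : ℝ) < n := by exact_mod_cast i₀.pos
  have hlamr0 : 0 < lamr := lt_of_le_of_ne (hi₀ ▸ hB.eigenvalues_nonneg i₀) hne.symm
  have hlam10 : 0 < lam1 := hlamr0.trans_le (hlam1.2 ⟨i₀, hi₀⟩)
  have hlamrn : lamr ≤ n := hi₀ ▸ eigenvalues_le_card_of_unit_diag hB hdiag i₀
  have hrate : 1 - (2-ω)*ω*lam1 / ((n : ℝ) * (lam1/lamr)) = 1 - (2-ω)*ω*lamr / n := by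
    field_simp
  rw [hrate]
  set c : ℝ := 1 - (2-ω)*ω*lamr / n with hc
  have hω : 0 ≤ (2-ω)*ω := mul_nonneg (by linarith) hω0.le
  have hnc : n * c = n - (2-ω)*ω*lamr := by rw [hc]; field_simp
  have hc0 : 0 ≤ n * c := by
    rw [hnc]
    nlinarith [mul_nonneg (sq_nonneg (ω - 1)) hlamr0.le]
  have hstep (e : Fin n → ℂ) :
      ∑ i, energySq B (e - ((ω : ℂ) * (B *ᵥ e) i) • (Pi.single i (1 : ℂ) : Fin n → ℂ)) ≤
        n * c * energySq B e := by
    have h := mul_energySq_le_sum_normSq hB (fun i hi => hmin ⟨⟨i, rfl⟩, hi⟩) e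
    simp only [energySq_sub_smul_single hB.1 e ω _ (hdiag _), Finset.sum_sub_distrib,
      Finset.sum_const, Finset.card_univ, Fintype.card_fin, nsmul_eq_mul, ← Finset.mul_sum]
    rw [hnc]
    linarith [mul_le_mul_of_nonneg_left h hω]
  have hsum (m : ℕ) : ∑ is : Fin m → Fin n, energySq B (ybar - y m is) ≤
      (n * c) ^ m * energySq B (ybar - y0) := by
    induction m with
    | zero => simp [hy0]
    | succ m ih =>
      rw [← (Fin.snocEquiv fun _ => Fin n).sum_comp, Fintype.sum_prod_type_right]
      have hy (is : Fin m → Fin n) (i : Fin n) :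
          ybar - y (m+1) (Fin.snocEquiv (fun _ => Fin n) (i, is)) = (ybar - y m is) -
            ((ω : ℂ) * (B *ᵥ (ybar - y m is)) i) • (Pi.single i (1 : ℂ) : Fin n → ℂ) := by
        have h1 : Fin.snocEquiv (fun _ => Fin n) (i, is) ∘ Fin.castSucc = is := by
          ext j
          simp [Fin.snocEquiv]
        have h2 : Fin.snocEquiv (fun _ => Fin n) (i, is) (Fin.last m) = i := by
          simp [Fin.snocEquiv]
        rw [hrec, h1, h2, mulVec_sub, hybar, sub_sub]
      simp only [hy]
      calc _ ≤ ∑ is : Fin m → Fin n, n * c * energySq B (ybar - y m is) :=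
            Finset.sum_le_sum fun is _ => hstep _
        _ ≤ n * c * ((n * c) ^ m * energySq B (ybar - y0)) := by
            rw [← Finset.mul_sum]
            exact mul_le_mul_of_nonneg_left ih hc0
        _ = _ := by ring
  rw [inv_mul_le_iff₀ (by positivity), ← mul_assoc, ← mul_pow]
  exact hsum _
end
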